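/- For every integer d ≥ 3, every centrally symmetric convex body B in ℝ^d (i.e. B = −B), every real number α with 0 ≤ α ≤ d − 1, every δ ∈ (0, 1/2), and every θ > 0, one has g_α(B) ≤ (2^d / (1 − δ)^d) · θ + ((1 + 2δ)^d · 2^α / δ^{d − α}) · e^{−θ}. -/

import Mathlib

open Set MeasureTheory Pointwise

/-- A convex body: a compact convex set with nonempty interior. -/
def IsConvexBody {E : Type*} [NormedAddCommGroup E] [NormedSpace ℝ E] (B : Set E) : Prop :=
  Convex ℝ B ∧ IsCompact B ∧ (interior B).Nonempty

/-- `gCov α B` is the infimum of `∑ λᵢ^α` over all finite translative coverings of `B`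
by homothets `xᵢ + λᵢ • B` with `λᵢ ∈ (0,1)`. -/
noncomputable def gCov {E : Type*} [NormedAddCommGroup E] [NormedSpace ℝ E]
    (α : ℝ) (B : Set E) : ℝ :=
  sInf {s : ℝ | ∃ (k : ℕ) (lam : Fin k → ℝ) (x : Fin k → E),
    (∀ i, lam i ∈ Set.Ioo (0 : ℝ) 1) ∧
    B ⊆ (⋃ i, x i +ᵥ lam i • B) ∧
    s = ∑ i, lam i ^ α}

section Symmetric

theorem neg_mem_smul_of_eq_neg {E : Type*} [AddCommGroup E] [Module ℝ E] {B : Set E}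
    (hsym : B = -B) {r : ℝ} {c : E} (hc : c ∈ r • B) : -c ∈ r • B := by
  obtain ⟨b, hb, rfl⟩ := hc
  exact ⟨-b, by rwa [hsym, Set.neg_mem_neg], smul_neg r b⟩

theorem IsConvexBody.zero_mem {E : Type*} [NormedAddCommGroup E] [NormedSpace ℝ E] {B : Set E}
    (hB : IsConvexBody B) (hsym : B = -B) : (0 : E) ∈ B := by
  obtain ⟨b, hb⟩ := hB.2.2.mono interior_subset
  have hb' : -b ∈ B := by rwa [hsym, Set.neg_mem_neg]
  simpa using hB.1.midpoint_mem hb hb'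

end Symmetric

section Averaging

variable {E : Type*} [NormedAddCommGroup E] [MeasurableSpace E] [BorelSpace E]
  [SecondCountableTopology E] (μ : Measure E) [SFinite μ] [μ.IsAddLeftInvariant] [μ.IsNegInvariant]

/-- Some translate of `C` by an element of `V` meets `U` in at least its average share, provided
that every translate of `C` meeting `U` is a translate by an element of `V`. -/
theorem exists_measure_mul_le_measure_inter_vadd {U C V : Set E} (hU : MeasurableSet U)
    (hC : MeasurableSet C) (hV : MeasurableSet V)
    (hUV : ∀ y ∈ U, ∀ x : E, y ∈ x +ᵥ C → x ∈ V) (hV0 : μ V ≠ 0) (hVtop : μ V ≠ ⊤)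
    (hUtop : μ U ≠ ⊤) (hCtop : μ C ≠ ⊤) :
    ∃ x : E, μ U * μ C ≤ μ (U ∩ (x +ᵥ C)) * μ V := by
  have hmeas : Measurable (fun p : E × E ↦ C.indicator (1 : E → ENNReal) (p.2 - p.1)) :=
    (measurable_one.indicator hC).comp (measurable_snd.sub measurable_fst)
  have hinner : ∀ x : E, ∫⁻ y in U, C.indicator (1 : E → ENNReal) (y - x) ∂μ =
      μ (U ∩ (x +ᵥ C)) := by
    intro x
    have h : ∀ y, C.indicator (1 : E → ENNReal) (y - x) =
        (x +ᵥ C).indicator (1 : E → ENNReal) y := by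
      intro y
      have : y ∈ x +ᵥ C ↔ y - x ∈ C := by
        rw [Set.mem_vadd_set_iff_neg_vadd_mem, vadd_eq_add, neg_add_eq_sub]
      by_cases h : y - x ∈ C <;> simp [this, h]
    simp_rw [h]
    rw [lintegral_indicator_one (hC.const_vadd x),
      Measure.restrict_apply (hC.const_vadd x), inter_comm]
  have houter : ∀ y ∈ U, ∫⁻ x in V, C.indicator (1 : E → ENNReal) (y - x) ∂μ = μ C := by
    intro y hy
    have hsub : MeasurableSet ((fun x ↦ y - x) ⁻¹' C) := (measurable_id.const_sub y) hC
    have hsV : (fun x ↦ y - x) ⁻¹' C ⊆ V := fun x hx ↦ hUV y hy x <| by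
      rwa [Set.mem_vadd_set_iff_neg_vadd_mem, vadd_eq_add, neg_add_eq_sub]
    calc ∫⁻ x in V, C.indicator (1 : E → ENNReal) (y - x) ∂μ
        = ∫⁻ x in V, ((fun x ↦ y - x) ⁻¹' C).indicator (1 : E → ENNReal) x ∂μ := rfl
      _ = μ ((fun x ↦ y - x) ⁻¹' C) := by
        rw [lintegral_indicator_one hsub, Measure.restrict_apply hsub, inter_eq_left.2 hsV]
      _ = μ C := (Measure.measurePreserving_sub_left μ y).measure_preimage hC.nullMeasurableSet
  have hint : ∫⁻ x in V, μ (U ∩ (x +ᵥ C)) ∂μ = μ U * μ C := by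
    simp_rw [← hinner]
    rw [lintegral_lintegral_swap hmeas.aemeasurable, setLIntegral_congr_fun hU houter,
      setLIntegral_const, mul_comm]
  obtain ⟨x, -, hx⟩ := exists_setLAverage_le (f := fun x ↦ μ (U ∩ (x +ᵥ C))) hV0
    hV.nullMeasurableSet (hint ▸ ENNReal.mul_ne_top hUtop hCtop)
  refine ⟨x, ?_⟩
  rwa [setLAverage_eq, hint, ENNReal.div_le_iff hV0 hVtop] at hx

end Averaging

section Covering

variable {E : Type*} [NormedAddCommGroup E] [NormedSpace ℝ E] [FiniteDimensional ℝ E]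
  [MeasurableSpace E] [BorelSpace E] (μ : Measure E) [μ.IsAddHaarMeasure]

theorem measureReal_smul_of_nonneg {r : ℝ} (hr : 0 ≤ r) (s : Set E) :
    μ.real (r • s) = r ^ Module.finrank ℝ E * μ.real s := by
  rw [Measure.real, Measure.addHaar_smul_of_nonneg μ hr, ENNReal.toReal_mul,
    ENNReal.toReal_ofReal (by positivity), Measure.real]

/-- Greedy placement of `N` translates of `r • B` inside `R • B + r • B ⊆ 2 • B`. -/
theorem exists_measureReal_sdiff_iUnion_le {B : Set E} (hB : IsConvexBody B) (hsym : B = -B)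
    {r R : ℝ} (hr : 0 ≤ r) (hR : 0 ≤ R) (hrR : R + r ≤ 2) (N : ℕ) :
    ∃ x : Fin N → E, μ.real ((R • B) \ ⋃ i, x i +ᵥ r • B) ≤
      (1 - (r / 2) ^ Module.finrank ℝ E) ^ N * (R ^ Module.finrank ℝ E * μ.real B) := by
  have hC : IsCompact (r • B) := hB.2.1.smul r
  have hD : IsCompact (R • B) := hB.2.1.smul R
  have hV : IsCompact ((2 : ℝ) • B) := hB.2.1.smul 2
  have hBpos : 0 < μ.real B := ENNReal.toReal_pos
    (Measure.measure_pos_of_nonempty_interior μ hB.2.2).ne' hB.2.1.measure_ne_top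
  induction N with
  | zero =>
    refine ⟨Fin.elim0, ?_⟩
    rw [pow_zero, one_mul, ← measureReal_smul_of_nonneg μ hR]
    exact measureReal_mono sdiff_subset hD.measure_ne_top
  | succ N ih =>
    obtain ⟨x, hx⟩ := ih
    set U := (R • B) \ ⋃ i, x i +ᵥ r • B with hUdef
    have hUm : MeasurableSet U := hD.measurableSet.diff
      (MeasurableSet.iUnion fun i ↦ hC.measurableSet.const_vadd (x i))
    have hUtop : μ U ≠ ⊤ := measure_ne_top_of_subset sdiff_subset hD.measure_ne_top
    have hVB : μ.real ((2 : ℝ) • B) = 2 ^ Module.finrank ℝ E * μ.real B :=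
      measureReal_smul_of_nonneg μ zero_le_two B
    have hV0 : μ ((2 : ℝ) • B) ≠ 0 := by
      rw [Measure.addHaar_smul_of_nonneg μ zero_le_two]
      exact mul_ne_zero (by simp) (Measure.measure_pos_of_nonempty_interior μ hB.2.2).ne'
    obtain ⟨z, hz⟩ := exists_measure_mul_le_measure_inter_vadd μ hUm hC.measurableSet
      hV.measurableSet (fun y hy z hyz ↦ by
        obtain ⟨c, hc, rfl⟩ := hyz
        have hneg : -c ∈ r • B := neg_mem_smul_of_eq_neg hsym hc
        have hmem : z ∈ (R + r) • B := by
          rw [hB.1.add_smul hR hr]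
          exact ⟨_, hy.1, _, hneg, by simp⟩
        obtain ⟨b, hb, rfl⟩ := hmem
        refine ⟨((R + r) / 2) • b, ?_, ?_⟩
        · exact hB.1.smul_mem_of_zero_mem (hB.zero_mem hsym) hb
            ⟨by positivity, by linarith⟩
        · simp only [smul_smul]
          congr 1
          ring)
      hV0 hV.measure_ne_top hUtop hC.measure_ne_top
    have hz' : μ.real U * (r / 2) ^ Module.finrank ℝ E ≤ μ.real (U ∩ (z +ᵥ r • B)) := by
      have h := ENNReal.toReal_mono (ENNReal.mul_ne_top
        (measure_ne_top_of_subset inter_subset_left hUtop) hV.measure_ne_top) hz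
      rw [ENNReal.toReal_mul, ENNReal.toReal_mul] at h
      change μ.real U * μ.real (r • B) ≤ μ.real _ * μ.real ((2 : ℝ) • B) at h
      rw [hVB, measureReal_smul_of_nonneg μ hr] at h
      rw [div_pow, ← mul_div_assoc, div_le_iff₀ (by positivity)]
      refine le_of_mul_le_mul_right ?_ hBpos
      linarith
    refine ⟨Fin.snoc x z, ?_⟩
    have hsplit := measureReal_inter_add_sdiff (μ := μ) (s := U)
      (hC.measurableSet.const_vadd z) hUtop
    have hset : (R • B) \ ⋃ i, (Fin.snoc x z : Fin (N + 1) → E) i +ᵥ r • B =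
        U \ (z +ᵥ r • B) := by
      ext y
      simp only [hUdef, mem_sdiff, mem_iUnion, Fin.exists_fin_succ', Fin.snoc_castSucc,
        Fin.snoc_last]
      tauto
    rw [hset, pow_succ]
    have hq : 0 ≤ 1 - (r / 2) ^ Module.finrank ℝ E :=
      sub_nonneg.2 (pow_le_one₀ (by positivity) (by linarith))
    nlinarith [mul_le_mul_of_nonneg_right hx hq]

/-- A maximal packing by translates of `δ • B` centred in `S` yields a covering of `S` by the
concentric translates of `(2 * δ) • B`. -/
theorem exists_covering_card_mul_le {B : Set E} (hB : IsConvexBody B) (hsym : B = -B)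
    {δ : ℝ} (hδ : 0 < δ) {S U : Set E} (hU : μ U ≠ ⊤) (hSU : ∀ y ∈ S, y +ᵥ δ • B ⊆ U) :
    ∃ Y : Finset E, S ⊆ ⋃ y ∈ Y, y +ᵥ (2 * δ) • B ∧
      Y.card * (δ ^ Module.finrank ℝ E * μ.real B) ≤ μ.real U := by
  classical
  have hC : IsCompact (δ • B) := hB.2.1.smul δ
  have hBpos : 0 < μ.real B := ENNReal.toReal_pos
    (Measure.measure_pos_of_nonempty_interior μ hB.2.2).ne' hB.2.1.measure_ne_top
  have hvol : 0 < δ ^ Module.finrank ℝ E * μ.real B := by positivity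
  let P : Finset E → Prop := fun Y ↦
    (Y : Set E) ⊆ S ∧ (Y : Set E).PairwiseDisjoint fun y ↦ y +ᵥ δ • B
  have hcard : ∀ Y, P Y → Y.card * (δ ^ Module.finrank ℝ E * μ.real B) ≤ μ.real U := by
    rintro Y ⟨hYS, hYd⟩
    have h := measureReal_biUnion_finset (μ := μ) hYd
      (fun y _ ↦ hC.measurableSet.const_vadd y)
      (fun y _ ↦ by rw [measure_vadd]; exact hC.measure_ne_top)
    have hconst : ∀ y : E, μ.real (y +ᵥ δ • B) = δ ^ Module.finrank ℝ E * μ.real B := fun y ↦ by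
      rw [Measure.real, measure_vadd, ← Measure.real, measureReal_smul_of_nonneg μ hδ.le]
    simp only [hconst, Finset.sum_const, nsmul_eq_mul] at h
    rw [← h]
    exact measureReal_mono (iUnion₂_subset fun y hy ↦ hSU y (hYS hy)) hU
  have hbdd : BddAbove {n : ℕ | ∃ Y, P Y ∧ Y.card = n} := by
    obtain ⟨n, hn⟩ := exists_nat_ge (μ.real U / (δ ^ Module.finrank ℝ E * μ.real B))
    refine ⟨n, ?_⟩
    rintro _ ⟨Y, hY, rfl⟩
    exact_mod_cast ((le_div_iff₀ hvol).2 (hcard Y hY)).trans hn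
  obtain ⟨Y, hY, hYmax⟩ :=
    Nat.sSup_mem (s := {n : ℕ | ∃ Y, P Y ∧ Y.card = n}) ⟨0, ∅, ⟨by simp, by simp⟩, rfl⟩ hbdd
  refine ⟨Y, fun s hs ↦ ?_, hcard Y hY⟩
  by_contra hcov
  simp only [mem_iUnion, not_exists] at hcov
  have hdisj : ∀ y ∈ Y, Disjoint (s +ᵥ δ • B) (y +ᵥ δ • B) := by
    intro y hy
    rw [Set.disjoint_left]
    rintro _ ⟨a, ha, rfl⟩ ⟨b, hb, hab⟩
    refine hcov y hy ?_
    have hneg : -a ∈ δ • B := neg_mem_smul_of_eq_neg hsym ha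
    rw [two_mul, hB.1.add_smul hδ.le hδ.le]
    refine ⟨b + -a, ⟨b, hb, -a, hneg, rfl⟩, ?_⟩
    simp only [vadd_eq_add] at hab ⊢
    rw [← add_assoc, hab]
    simp
  have hsY : s ∉ Y := fun h ↦ hcov s h ⟨0, ⟨0, hB.zero_mem hsym, by simp⟩, by simp⟩
  have hins : P (insert s Y) := by
    refine ⟨?_, ?_⟩
    · rw [Finset.coe_insert]
      exact insert_subset hs hY.1
    · rw [Finset.coe_insert]
      exact hY.2.insert fun y hy _ ↦ hdisj y hy
  have hle := le_csSup hbdd ⟨_, hins, rfl⟩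
  rw [← hYmax, Finset.card_insert_of_notMem hsY] at hle
  omega

end Covering

section

variable {E : Type*} [NormedAddCommGroup E] [NormedSpace ℝ E]

theorem gCov_le_sum {ι : Type*} [Fintype ι] {α : ℝ} {B : Set E} {lam : ι → ℝ} {x : ι → E}
    (hlam : ∀ i, lam i ∈ Set.Ioo (0 : ℝ) 1) (hcov : B ⊆ ⋃ i, x i +ᵥ lam i • B) :
    gCov α B ≤ ∑ i, lam i ^ α := by
  let e := Fintype.equivFin ι
  refine csInf_le ⟨0, ?_⟩ ⟨Fintype.card ι, lam ∘ e.symm, x ∘ e.symm, fun i ↦ hlam _, ?_, ?_⟩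
  · rintro _ ⟨k, l, y, hl, -, rfl⟩
    exact Finset.sum_nonneg fun i _ ↦ Real.rpow_nonneg (hl i).1.le _
  · refine hcov.trans (iUnion_subset fun i ↦ ?_)
    convert subset_iUnion (fun j ↦ (x ∘ e.symm) j +ᵥ (lam ∘ e.symm) j • B) (e i) using 1
    simp
  · exact (e.symm.sum_comp fun i ↦ lam i ^ α).symm

end

section

variable {E : Type*} [NormedAddCommGroup E] [NormedSpace ℝ E] [FiniteDimensional ℝ E]

theorem gCov_le_nat_add_of_lt_one {B : Set E} (hB : IsConvexBody B)
    (hsym : B = -B) {α δ t : ℝ} (hα : 0 ≤ α) (hδ : δ ∈ Set.Ioo (0 : ℝ) (1 / 2))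
    (ht : t ∈ Set.Ioo δ 1) (N : ℕ) :
    gCov α B ≤ N + (1 + δ) ^ Module.finrank ℝ E * (2 * δ) ^ α / δ ^ Module.finrank ℝ E *
      (1 - ((t - δ) / 2) ^ Module.finrank ℝ E) ^ N := by
  obtain ⟨hδ0, hδ1⟩ := hδ
  obtain ⟨hδt, ht1⟩ := ht
  borelize E
  let μ : Measure E := Measure.addHaar
  have hBpos : 0 < μ.real B := ENNReal.toReal_pos
    (Measure.measure_pos_of_nonempty_interior μ hB.2.2).ne' hB.2.1.measure_ne_top
  obtain ⟨x, hx⟩ := exists_measureReal_sdiff_iUnion_le μ hB hsym (r := t - δ) (R := 1 + δ)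
    (by linarith) (by linarith) (by linarith) N
  obtain ⟨Y, hSY, hY⟩ := exists_covering_card_mul_le μ hB hsym hδ0
    (S := B \ ⋃ i, x i +ᵥ t • B) (U := ((1 + δ) • B) \ ⋃ i, x i +ᵥ (t - δ) • B)
    (measure_ne_top_of_subset sdiff_subset (hB.2.1.smul (1 + δ)).measure_ne_top) (by
      rintro y ⟨hyB, hy⟩ _ ⟨c, hc, rfl⟩
      refine ⟨?_, fun h ↦ hy ?_⟩
      · rw [hB.1.add_smul zero_le_one hδ0.le, one_smul]
        exact ⟨y, hyB, c, hc, rfl⟩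
      · obtain ⟨i, b, hb, hbc⟩ := mem_iUnion.1 h
        have hneg : -c ∈ δ • B := neg_mem_smul_of_eq_neg hsym hc
        refine mem_iUnion.2 ⟨i, b + -c, ?_, ?_⟩
        · rw [← sub_add_cancel t δ, hB.1.add_smul (by linarith) hδ0.le]
          exact ⟨b, hb, -c, hneg, rfl⟩
        · simp only [vadd_eq_add] at hbc ⊢
          rw [← add_assoc, hbc]
          simp)
  have hg : gCov α B ≤ ∑ i : Fin N ⊕ Y, (Sum.elim (fun _ ↦ t) (fun _ ↦ 2 * δ) i : ℝ) ^ α := by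
    refine gCov_le_sum (x := Sum.elim x Subtype.val) ?_ fun b hb ↦ ?_
    · rintro (i | y)
      · exact ⟨hδ0.trans hδt, ht1⟩
      · exact ⟨by simpa using hδ0, by simp only [Sum.elim_inr]; linarith⟩
    · by_cases hbU : b ∈ ⋃ i, x i +ᵥ t • B
      · obtain ⟨i, hi⟩ := mem_iUnion.1 hbU
        exact mem_iUnion.2 ⟨Sum.inl i, hi⟩
      · obtain ⟨y, hyY, hy⟩ := mem_iUnion₂.1 (hSY ⟨hb, hbU⟩)
        exact mem_iUnion.2 ⟨Sum.inr ⟨y, hyY⟩, hy⟩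
  simp only [Fintype.sum_sum_type, Sum.elim_inl, Sum.elim_inr, Finset.sum_const, Finset.card_univ,
    Fintype.card_fin, Fintype.card_coe, nsmul_eq_mul] at hg
  have htα : t ^ α ≤ 1 := Real.rpow_le_one (hδ0.trans hδt).le ht1.le hα
  have hYcard : (Y.card : ℝ) ≤ (1 - ((t - δ) / 2) ^ Module.finrank ℝ E) ^ N *
      (1 + δ) ^ Module.finrank ℝ E / δ ^ Module.finrank ℝ E := by
    rw [le_div_iff₀ (by positivity)]
    refine le_of_mul_le_mul_right ?_ hBpos
    linarith [hY.trans hx]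
  calc gCov α B ≤ N * t ^ α + Y.card * (2 * δ) ^ α := hg
    _ ≤ N * 1 + (1 - ((t - δ) / 2) ^ Module.finrank ℝ E) ^ N *
      (1 + δ) ^ Module.finrank ℝ E / δ ^ Module.finrank ℝ E * (2 * δ) ^ α := by gcongr
    _ = _ := by ring

open Filter Topology in
theorem gCov_le_nat_add {B : Set E} (hB : IsConvexBody B)
    (hsym : B = -B) {α δ : ℝ} (hα : 0 ≤ α) (hδ : δ ∈ Set.Ioo (0 : ℝ) (1 / 2)) (N : ℕ) :
    gCov α B ≤ N + (1 + δ) ^ Module.finrank ℝ E * (2 * δ) ^ α / δ ^ Module.finrank ℝ E *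
      (1 - ((1 - δ) / 2) ^ Module.finrank ℝ E) ^ N := by
  have hcont : Continuous fun t : ℝ ↦
      N + (1 + δ) ^ Module.finrank ℝ E * (2 * δ) ^ α / δ ^ Module.finrank ℝ E *
        (1 - ((t - δ) / 2) ^ Module.finrank ℝ E) ^ N := by fun_prop
  refine ge_of_tendsto (hcont.continuousWithinAt (s := Set.Iio 1)).tendsto ?_
  filter_upwards [Ioo_mem_nhdsLT (show δ < 1 by linarith [hδ.2])] with t ht
  exact gCov_le_nat_add_of_lt_one hB hsym hα hδ ht N

end

theorem le_add_mul_exp_of_forall_nat {g K q m : ℝ} (hm : 0 ≤ m)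
    (h : ∀ N : ℕ, g ≤ N + K * q ^ N) : g ≤ m + K * Real.exp (-(m * (1 - q))) := by
  have hexp : ∀ x : ℝ, HasSum (fun n : ℕ ↦ x ^ n / n.factorial) (Real.exp x) := fun x ↦ by
    rw [Real.exp_eq_exp_ℝ]
    exact NormedSpace.expSeries_div_hasSum_exp x
  have h1 : HasSum (fun n : ℕ ↦ (n : ℝ) * (m ^ n / n.factorial)) (m * Real.exp m) := by
    rw [← hasSum_nat_add_iff' 1]
    simp only [Finset.range_one, Finset.sum_singleton, Nat.cast_zero, zero_mul, sub_zero]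
    refine ((hexp m).mul_left m).congr_fun fun n ↦ ?_
    rw [Nat.factorial_succ, pow_succ]
    push_cast
    field_simp
  have h2 : HasSum (fun n : ℕ ↦ (n + K * q ^ n) * (m ^ n / n.factorial))
      (m * Real.exp m + K * Real.exp (m * q)) := by
    convert h1.add ((hexp (m * q)).mul_left K) using 2 with n
    rw [mul_pow]
    ring
  have h3 := hasSum_le (fun n ↦ mul_le_mul_of_nonneg_right (h n) (by positivity))
    ((hexp m).mul_left g) h2
  rw [show -(m * (1 - q)) = m * q - m by ring, Real.exp_sub]
  have := Real.exp_pos m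
  rw [← mul_le_mul_iff_left₀ this]
  convert h3 using 1
  field_simp

/-- For every `d ≥ 3`, every centrally symmetric convex body `B ⊆ ℝ^d`, every
`0 ≤ α ≤ d - 1`, every `δ ∈ (0, 1/2)`, and every `θ > 0`,
`g_α(B) ≤ (2^d / (1-δ)^d) θ + ((1+2δ)^d 2^α / δ^{d-α}) e^{-θ}`. -/
theorem gCov_two_sizes_bound (d : ℕ) (hd : 3 ≤ d)
    (B : Set (EuclideanSpace ℝ (Fin d))) (hB : IsConvexBody B) (hsym : B = -B)
    (α : ℝ) (hα0 : 0 ≤ α) (hαd : α ≤ (d : ℝ) - 1)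
    (δ : ℝ) (hδ : δ ∈ Set.Ioo (0 : ℝ) (1 / 2)) (θ : ℝ) (hθ : 0 < θ) :
    gCov α B ≤
      (2 ^ d / (1 - δ) ^ d) * θ +
        ((1 + 2 * δ) ^ d * (2 : ℝ) ^ α / δ ^ ((d : ℝ) - α)) * Real.exp (-θ) := by
  obtain ⟨hδ0, hδ1⟩ := hδ
  have h1δ : 0 < 1 - δ := by linarith
  have h := le_add_mul_exp_of_forall_nat (m := 2 ^ d / (1 - δ) ^ d * θ) (by positivity)
    (gCov_le_nat_add hB hsym hα0 ⟨hδ0, hδ1⟩)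
  rw [finrank_euclideanSpace_fin] at h
  have hexp : 2 ^ d / (1 - δ) ^ d * θ * (1 - (1 - ((1 - δ) / 2) ^ d)) = θ := by
    rw [div_pow]
    field_simp
    ring
  rw [hexp] at h
  refine h.trans ?_
  have hK : (2 * δ) ^ α / δ ^ d = 2 ^ α / δ ^ ((d : ℝ) - α) := by
    rw [Real.mul_rpow zero_le_two hδ0.le, Real.rpow_sub hδ0, Real.rpow_natCast]
    field_simp
  rw [mul_div_assoc, hK, ← mul_div_assoc]
  gcongr
  linarith
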